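/- arXiv:1510.05979 — 2 statements merged into one kernel-verified Lean document; each statement's English description precedes it below -/
import Mathlib

section
/- Let 0 < σ < 1, let v > 0, and let y : ℝ → ℝ^d be a 1-periodic C² function defining a regular simple closed curve. Then y is an extremal of the action 𝒜^σ — i.e., d/dε 𝒜^σ(y + εz)|_{ε=0} = 0 for every 1-periodic C² function z : ℝ → ℝ^d — if and only if y satisfies, for all s ∈ ℝ, the equation v² ÿ(s) = −lim_{δ→0⁺} ∫_{s+δ}^{1+s−δ} σ(y(s) − y(r))/‖y(s) − y(r)‖^{2+σ} dr. -/
open MeasureTheory Real Filter Topology intervalIntegral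

/-- The action functional
`𝒜^σ(y) = ∫₀¹ (v²/2)‖ẏ(s)‖² ds + (1/2)∫₀¹∫₀¹ ‖y(s) − y(r)‖^{−σ} dr ds`. -/
noncomputable def actionA (d : ℕ) (σ v : ℝ) (y : ℝ → EuclideanSpace ℝ (Fin d)) : ℝ :=
  (∫ s in (0 : ℝ)..1, v ^ 2 / 2 * ‖deriv y s‖ ^ 2) +
    1 / 2 * ∫ s in (0 : ℝ)..1, ∫ r in (0 : ℝ)..1, ‖y s - y r‖ ^ (-σ)

section Kernel

variable {E : Type*} [NormedAddCommGroup E] [InnerProductSpace ℝ E]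

/-- The gradient kernel `w ↦ σ w / ‖w‖ ^ (2 + σ)`. -/
noncomputable def gradKernel (σ : ℝ) (w : E) : E := (σ / ‖w‖ ^ (2 + σ)) • w

/-- The kernel along a curve, symmetrized in the parameter increment. -/
noncomputable def symKernel (σ : ℝ) (y : ℝ → E) (s u : ℝ) : E :=
  gradKernel σ (y s - y (s + u)) + gradKernel σ (y s - y (s - u))

lemma gradKernel_neg (σ : ℝ) (w : E) : gradKernel σ (-w) = -gradKernel σ w := by
  simp [gradKernel]

lemma continuousAt_gradKernel (σ : ℝ) {w : E} (hw : w ≠ 0) :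
    ContinuousAt (gradKernel σ) w := by
  have h : 0 < ‖w‖ := norm_pos_iff.mpr hw
  have h1 : ContinuousAt (fun w : E => ‖w‖ ^ (2 + σ)) w :=
    continuous_norm.continuousAt.rpow_const (Or.inl h.ne')
  exact (continuousAt_const.div h1 (rpow_pos_of_pos h _).ne').smul continuousAt_id

lemma measurable_gradKernel [MeasurableSpace E] [BorelSpace E] [SecondCountableTopology E]
    (σ : ℝ) : Measurable (gradKernel σ : E → E) := by
  unfold gradKernel
  fun_prop

lemma rpow_neg_sub_rpow_neg_le {a b p : ℝ} (ha : 0 < a) (hab : a ≤ b) (hp : 0 ≤ p) :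
    a ^ (-p) - b ^ (-p) ≤ p * a ^ (-p) * ((b - a) / a) := by
  have hb : 0 < b := ha.trans_le hab
  have hba : 0 < b / a := div_pos hb ha
  have h1 : 1 - p * ((b - a) / a) ≤ (b / a) ^ (-p) := by
    rw [rpow_def_of_pos hba]
    have h2 := Real.add_one_le_exp (Real.log (b / a) * -p)
    have h3 := Real.log_le_sub_one_of_pos hba
    have h4 : b / a - 1 = (b - a) / a := by field_simp
    nlinarith
  have h5 : b ^ (-p) = (b / a) ^ (-p) * a ^ (-p) := by
    rw [← mul_rpow hba.le ha.le, div_mul_cancel₀ _ ha.ne']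
  have h6 : 0 < a ^ (-p) := rpow_pos_of_pos ha _
  rw [h5]
  nlinarith

lemma norm_gradKernel_sub_le {σ t : ℝ} (hσ : 0 < σ) (ht : 0 < t) {w w' : E}
    (hw : t ≤ ‖w‖) (hw' : t ≤ ‖w'‖) :
    ‖gradKernel σ w - gradKernel σ w'‖ ≤ σ * (3 + σ) * t ^ (-(2 + σ)) * ‖w - w'‖ := by
  wlog hle : ‖w‖ ≤ ‖w'‖ generalizing w w'
  · rw [norm_sub_rev, norm_sub_rev w]
    exact this hw' hw (le_of_not_ge hle)
  have ha : 0 < ‖w‖ := ht.trans_le hw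
  have hb : 0 < ‖w'‖ := ht.trans_le hw'
  set p := 2 + σ with hp
  have hp0 : 0 ≤ p := by positivity
  have key : gradKernel σ w - gradKernel σ w' =
      (σ * ‖w'‖ ^ (-p)) • (w - w') + (σ * (‖w‖ ^ (-p) - ‖w'‖ ^ (-p))) • w := by
    simp only [gradKernel, ← hp, rpow_neg (norm_nonneg _), div_eq_mul_inv]
    module
  have h1 := rpow_neg_sub_rpow_neg_le ha hle hp0
  have h2 : ‖w'‖ ^ (-p) ≤ t ^ (-p) := rpow_le_rpow_of_nonpos ht hw' (by linarith)
  have h2' : ‖w‖ ^ (-p) ≤ t ^ (-p) := rpow_le_rpow_of_nonpos ht hw (by linarith)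
  have h3 : ‖w'‖ ^ (-p) ≤ ‖w‖ ^ (-p) := rpow_le_rpow_of_nonpos ha hle (by linarith)
  have h4 : ‖w'‖ - ‖w‖ ≤ ‖w - w'‖ := by
    rw [norm_sub_rev]; exact norm_sub_norm_le _ _
  have h5 : 0 < t ^ (-p) := rpow_pos_of_pos ht _
  have h6 : (‖w‖ ^ (-p) - ‖w'‖ ^ (-p)) * ‖w‖ ≤ p * t ^ (-p) * ‖w - w'‖ := by
    calc (‖w‖ ^ (-p) - ‖w'‖ ^ (-p)) * ‖w‖
        ≤ p * ‖w‖ ^ (-p) * ((‖w'‖ - ‖w‖) / ‖w‖) * ‖w‖ := by gcongr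
      _ = p * ‖w‖ ^ (-p) * (‖w'‖ - ‖w‖) := by field_simp
      _ ≤ p * t ^ (-p) * ‖w - w'‖ := by
        have : 0 ≤ ‖w'‖ - ‖w‖ := by linarith
        gcongr
  rw [key]
  refine (norm_add_le _ _).trans ?_
  rw [norm_smul, norm_smul, Real.norm_of_nonneg (by positivity),
    Real.norm_of_nonneg (mul_nonneg hσ.le (by linarith))]
  calc σ * ‖w'‖ ^ (-p) * ‖w - w'‖ + σ * (‖w‖ ^ (-p) - ‖w'‖ ^ (-p)) * ‖w‖
      = σ * (‖w'‖ ^ (-p) * ‖w - w'‖ + (‖w‖ ^ (-p) - ‖w'‖ ^ (-p)) * ‖w‖) := by ring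
    _ ≤ σ * (t ^ (-p) * ‖w - w'‖ + p * t ^ (-p) * ‖w - w'‖) := by gcongr
    _ = σ * (3 + σ) * t ^ (-p) * ‖w - w'‖ := by rw [hp]; ring

lemma hasDerivAt_norm_add_smul_rpow (σ : ℝ) (w ζ : E) (ε : ℝ) (hw : w + ε • ζ ≠ 0) :
    HasDerivAt (fun ε : ℝ => ‖w + ε • ζ‖ ^ (-σ))
      (-inner ℝ (gradKernel σ (w + ε • ζ)) ζ) ε := by
  have h1 : HasDerivAt (fun ε : ℝ => w + ε • ζ) ζ ε := by
    simpa using ((hasDerivAt_id ε).smul_const ζ).const_add w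
  have h2 := h1.norm_sq
  have hpos : 0 < ‖w + ε • ζ‖ := norm_pos_iff.mpr hw
  have h3 := h2.rpow_const (p := -σ / 2) (Or.inl (by positivity))
  have h4 : (fun ε : ℝ => ‖w + ε • ζ‖ ^ (-σ)) =
      fun ε : ℝ => (‖w + ε • ζ‖ ^ 2) ^ (-σ / 2) := by
    funext ε
    rw [← rpow_natCast, ← rpow_mul (norm_nonneg _)]
    congr 1
    push_cast
    ring
  rw [h4]
  convert h3 using 1
  rw [gradKernel, inner_smul_left, ← rpow_natCast, ← rpow_mul (norm_nonneg _),
    div_eq_mul_inv, ← rpow_neg (norm_nonneg _)]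
  have h5 : ((2 : ℕ) : ℝ) * (-σ / 2 - 1) = -(2 + σ) := by push_cast; ring
  rw [h5]
  simp
  ring

lemma norm_inner_gradKernel_le {σ t : ℝ} (hσ : 0 < σ) (ht : 0 < t) {w : E} (hw : t ≤ ‖w‖)
    (ζ : E) : ‖inner ℝ (gradKernel σ w) ζ‖ ≤ σ * t ^ (-(1 + σ)) * ‖ζ‖ := by
  have ha : 0 < ‖w‖ := ht.trans_le hw
  refine (norm_inner_le_norm _ _).trans ?_
  gcongr
  rw [gradKernel, norm_smul, Real.norm_of_nonneg (by positivity), div_mul_eq_mul_div,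
    mul_div_assoc]
  have : ‖w‖ / ‖w‖ ^ (2 + σ) = ‖w‖ ^ (-(1 + σ)) := by
    rw [← rpow_one_sub' ha.le (by linarith)]
    congr 1; ring
  rw [this]
  exact mul_le_mul_of_nonneg_left (rpow_le_rpow_of_nonpos ht hw (by linarith)) hσ.le

end Kernel

section Curve

variable {E : Type*} [NormedAddCommGroup E]

lemma exists_norm_le_of_periodic {f : ℝ → E} (hf : Function.Periodic f 1)
    (hc : Continuous f) : ∃ C, 0 < C ∧ ∀ x, ‖f x‖ ≤ C := by
  obtain ⟨C, hC⟩ := isCompact_Icc.exists_bound_of_continuousOn (s := Set.Icc (0 : ℝ) 1)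
    hc.continuousOn
  refine ⟨max C 1, by positivity, fun x => ?_⟩
  obtain ⟨t, ht, hxt⟩ := hf.exists_mem_Ico₀ one_pos x
  rw [hxt]
  exact (hC t ⟨ht.1, ht.2.le⟩).trans (le_max_left _ _)

lemma sub_ne_zero_of_injOn {y : ℝ → E} (hper : Function.Periodic y 1)
    (hinj : Set.InjOn y (Set.Ico (0 : ℝ) 1)) (s : ℝ) {u : ℝ} (hu : u ∈ Set.Ioo (0 : ℝ) 1) :
    y s - y (s + u) ≠ 0 := by
  intro h0
  have h1 : y s = y (s + u) := sub_eq_zero.mp h0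
  have e1 : ∀ x, y (Int.fract x) = y x := fun x => by
    have := hper.sub_int_mul_eq (x := x) ⌊x⌋
    rwa [mul_one] at this
  have h2 : Int.fract s = Int.fract (s + u) := by
    apply hinj ⟨Int.fract_nonneg _, Int.fract_lt_one _⟩ ⟨Int.fract_nonneg _, Int.fract_lt_one _⟩
    rw [e1, e1, h1]
  obtain ⟨n, hn⟩ := Int.fract_eq_fract.mp h2
  have h3 : u = -(n : ℝ) := by linarith
  rw [h3] at hu
  have a1 : (n : ℝ) < ((0 : ℤ) : ℝ) := by push_cast; linarith [hu.1]
  have a2 : ((-1 : ℤ) : ℝ) < (n : ℝ) := by push_cast; linarith [hu.2]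
  rw [Int.cast_lt] at a1 a2
  omega

variable [NormedSpace ℝ E]

lemma periodic_deriv {f : ℝ → E} (hf : Function.Periodic f 1) :
    Function.Periodic (deriv f) 1 := by
  intro x
  rw [← deriv_comp_add_const, funext hf]

lemma exists_norm_sub_le_of_periodic {f : ℝ → E} (hf : Function.Periodic f 1)
    (hc : ContDiff ℝ 1 f) : ∃ M, 0 < M ∧ ∀ x x', ‖f x - f x'‖ ≤ M * |x - x'| := by
  obtain ⟨M, hM, h⟩ := exists_norm_le_of_periodic (periodic_deriv hf)
    (hc.continuous_deriv le_rfl)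
  refine ⟨M, hM, fun x x' => ?_⟩
  exact Convex.norm_image_sub_le_of_norm_deriv_le
    (fun x _ => (hc.differentiable one_ne_zero).differentiableAt) (fun x _ => h x)
    convex_univ (Set.mem_univ x') (Set.mem_univ x)

lemma exists_norm_sub_le_min {f : ℝ → E} (hf : Function.Periodic f 1)
    (hc : ContDiff ℝ 1 f) :
    ∃ M, 0 < M ∧ ∀ s, ∀ u ∈ Set.Ioo (0 : ℝ) 1, ‖f s - f (s + u)‖ ≤ M * min u (1 - u) := by
  obtain ⟨M, hM, h⟩ := exists_norm_sub_le_of_periodic hf hc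
  refine ⟨M, hM, fun s u hu => ?_⟩
  rw [mul_min_of_nonneg _ _ hM.le, le_min_iff]
  constructor
  · simpa [abs_of_pos hu.1] using h s (s + u)
  · have := h (s + 1) (s + u)
    rwa [hf s, add_sub_add_left_eq_sub, abs_of_pos (by linarith [hu.2])] at this

lemma contDiff_one_deriv {f : ℝ → E} (hc : ContDiff ℝ 2 f) : ContDiff ℝ 1 (deriv f) := by
  have : ContDiff ℝ (1 + 1) f := hc.of_le (by norm_num)
  exact (contDiff_succ_iff_deriv.mp this).2.2

lemma exists_second_diff_le {f : ℝ → E} (hf : Function.Periodic f 1)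
    (hc : ContDiff ℝ 2 f) :
    ∃ B, 0 < B ∧ ∀ s, ∀ u, 0 ≤ u → ‖(f s - f (s + u)) - (f (s - u) - f s)‖ ≤ B * u ^ 2 := by
  have hc1 : ContDiff ℝ 1 (deriv f) := contDiff_one_deriv hc
  have hd : Differentiable ℝ f := hc.differentiable two_ne_zero
  obtain ⟨M, hM, h⟩ := exists_norm_sub_le_of_periodic (periodic_deriv hf) hc1
  refine ⟨2 * M, by positivity, fun s u hu => ?_⟩
  have hder : ∀ x ∈ Set.Icc 0 u, HasDerivWithinAt (fun x => f (s + x) + f (s - x))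
      (deriv f (s + x) - deriv f (s - x)) (Set.Icc 0 u) x := fun x _ => by
    have h1 := (hd (s + x)).hasDerivAt.comp_const_add s x
    have h2 := (hd (s - x)).hasDerivAt.comp_const_sub s x
    rw [sub_eq_add_neg]
    exact (h1.add h2).hasDerivWithinAt
  have := Convex.norm_image_sub_le_of_norm_hasDerivWithin_le (C := 2 * M * u) hder
    (fun x hx => ?_) (convex_Icc 0 u) (Set.left_mem_Icc.mpr hu) (Set.right_mem_Icc.mpr hu)
  · rw [← norm_neg]
    convert this using 1
    · congr 1
      simp only [add_zero, sub_zero]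
      abel
    · rw [sub_zero, Real.norm_of_nonneg hu]; ring
  · refine (h _ _).trans ?_
    have : s + x - (s - x) = 2 * x := by ring
    rw [this, abs_of_nonneg (by linarith [hx.1])]
    nlinarith [hx.2]

lemma exists_le_norm_sub [CompleteSpace E] {y : ℝ → E} (hper : Function.Periodic y 1)
    (hC : ContDiff ℝ 1 y) (hreg : ∀ s : ℝ, deriv y s ≠ 0)
    (hinj : Set.InjOn y (Set.Ico (0 : ℝ) 1)) :
    ∃ c, 0 < c ∧ ∀ s, ∀ u ∈ Set.Ioo (0 : ℝ) 1, c * min u (1 - u) ≤ ‖y s - y (s + u)‖ := by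
  have hd : Continuous (deriv y) := hC.continuous_deriv le_rfl
  set q : ℝ × ℝ → E := fun p => ∫ t in (0 : ℝ)..1, deriv y (p.1 + p.2 * t) with hq
  have hqc : Continuous q := by
    apply intervalIntegral.continuous_parametric_intervalIntegral_of_continuous'
    fun_prop
  have hqe : ∀ s u, u • q (s, u) = y (s + u) - y s := fun s u => by
    rw [hq]
    simp only
    rw [intervalIntegral.smul_integral_comp_add_mul (deriv y) u s]
    rw [intervalIntegral.integral_deriv_eq_sub
      (fun x _ => (hC.differentiable one_ne_zero).differentiableAt)
      (hd.intervalIntegrable _ _)]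
    simp
  have hK : IsCompact (Set.Icc (0 : ℝ) 1 ×ˢ Set.Icc (0 : ℝ) (1 / 2)) :=
    isCompact_Icc.prod isCompact_Icc
  obtain ⟨⟨s0, u0⟩, hm, hmin⟩ := hK.exists_isMinOn
    ⟨(0, 0), by constructor <;> constructor <;> norm_num⟩ hqc.norm.continuousOn
  have hpos : 0 < ‖q (s0, u0)‖ := by
    rw [norm_pos_iff]
    rcases eq_or_lt_of_le hm.2.1 with h | h
    · simp only at h
      rw [← h, hq]
      simpa using hreg s0
    · intro h0
      have := hqe s0 u0
      rw [h0, smul_zero] at this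
      have hu2 : u0 ≤ 1 / 2 := hm.2.2
      apply sub_ne_zero_of_injOn hper hinj s0 (u := u0) ⟨h, by linarith⟩
      rw [← neg_sub, ← this, neg_zero]
  have key : ∀ s, ∀ u, 0 ≤ u → u ≤ 1 / 2 → ‖q (s0, u0)‖ * u ≤ ‖y s - y (s + u)‖ := by
    intro s u hu hu2
    have hp : Function.Periodic (fun s => y s - y (s + u)) 1 := fun x => by
      change y (x + 1) - y (x + 1 + u) = y x - y (x + u)
      rw [hper x, add_right_comm, hper]
    obtain ⟨t, ht, hst⟩ := hp.exists_mem_Ico₀ one_pos s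
    change y s - y (s + u) = y t - y (t + u) at hst
    rw [hst, norm_sub_rev, ← hqe, norm_smul, Real.norm_of_nonneg hu, mul_comm]
    gcongr
    exact hmin ⟨⟨ht.1, ht.2.le⟩, hu, hu2⟩
  refine ⟨_, hpos, fun s u hu => ?_⟩
  rcases le_total u (1 / 2) with h | h
  · refine le_trans ?_ (key s u hu.1.le h)
    gcongr
    exact min_le_left _ _
  · have := key (s + u) (1 - u) (by linarith [hu.2]) (by linarith)
    rw [show s + u + (1 - u) = s + 1 by ring, hper, norm_sub_rev] at this
    refine le_trans ?_ this
    gcongr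
    exact min_le_right _ _

end Curve

section Energy

/-- Lebesgue measure on the open unit interval. -/
noncomputable abbrev unitMeasure : Measure ℝ := volume.restrict (Set.Ioo (0 : ℝ) 1)

lemma intervalIntegral_eq_integral_unitMeasure {E : Type*} [NormedAddCommGroup E]
    [NormedSpace ℝ E] (f : ℝ → E) : ∫ x in (0 : ℝ)..1, f x = ∫ x, f x ∂unitMeasure := by
  rw [intervalIntegral.integral_of_le zero_le_one, integral_Ioc_eq_integral_Ioo]

lemma ae_unitMeasure_prod_mem :
    ∀ᵐ p ∂(unitMeasure.prod unitMeasure), p.2 ∈ Set.Ioo (0 : ℝ) 1 :=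
  Measure.quasiMeasurePreserving_snd.ae (ae_restrict_mem measurableSet_Ioo)

lemma integrable_min_rpow {σ : ℝ} (hσ1 : σ < 1) :
    Integrable (fun u : ℝ => (min u (1 - u)) ^ (-σ)) unitMeasure := by
  have h1 : IntervalIntegrable (fun u : ℝ => u ^ (-σ)) volume 0 1 :=
    intervalIntegral.intervalIntegrable_rpow' (by linarith)
  have h2 : IntervalIntegrable (fun u : ℝ => (1 - u) ^ (-σ)) volume 0 1 := by
    simpa using (h1.comp_sub_left 1).symm
  have h3 := (h1.add h2).1.mono_set Set.Ioo_subset_Ioc_self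
  refine Integrable.mono' h3 (Measurable.aestronglyMeasurable (by fun_prop)) ?_
  filter_upwards [ae_restrict_mem measurableSet_Ioo] with u hu
  have a1 : 0 ≤ u ^ (-σ) := rpow_nonneg hu.1.le _
  have a2 : 0 ≤ (1 - u) ^ (-σ) := rpow_nonneg (by linarith [hu.2]) _
  change _ ≤ u ^ (-σ) + (1 - u) ^ (-σ)
  rcases min_choice u (1 - u) with h | h <;> rw [h, Real.norm_of_nonneg (by assumption)] <;>
    linarith

lemma min_self_one_sub_pos {u : ℝ} (hu : u ∈ Set.Ioo (0 : ℝ) 1) : 0 < min u (1 - u) :=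
  lt_min hu.1 (by linarith [hu.2])

lemma integrable_prod_of_norm_le_min_rpow {F : Type*} [NormedAddCommGroup F] {σ C : ℝ}
    (hσ1 : σ < 1) {f : ℝ × ℝ → F}
    (hf : AEStronglyMeasurable f (unitMeasure.prod unitMeasure))
    (h : ∀ s, ∀ u ∈ Set.Ioo (0 : ℝ) 1, ‖f (s, u)‖ ≤ C * (min u (1 - u)) ^ (-σ)) :
    Integrable f (unitMeasure.prod unitMeasure) := by
  refine Integrable.mono' (((integrable_min_rpow hσ1).const_mul C).comp_snd unitMeasure)
    hf ?_
  filter_upwards [ae_unitMeasure_prod_mem] with p hp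
  exact h p.1 p.2 hp

lemma integral_comp_add_of_periodic {F : Type*} [NormedAddCommGroup F] [NormedSpace ℝ F]
    {f : ℝ → F} (hf : Function.Periodic f 1) (s : ℝ) :
    ∫ u, f (s + u) ∂unitMeasure = ∫ u, f u ∂unitMeasure := by
  rw [← intervalIntegral_eq_integral_unitMeasure, ← intervalIntegral_eq_integral_unitMeasure,
    intervalIntegral.integral_comp_add_left f s, add_zero, hf.intervalIntegral_add_eq s 0,
    zero_add]

variable {E : Type*} [NormedAddCommGroup E]

lemma double_integral_eq_of_periodic {y : ℝ → E} (hy : Function.Periodic y 1) (F : E → ℝ) :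
    ∫ s in (0 : ℝ)..1, ∫ r in (0 : ℝ)..1, F (y s - y r) =
      ∫ s, ∫ u, F (y s - y (s + u)) ∂unitMeasure ∂unitMeasure := by
  rw [intervalIntegral_eq_integral_unitMeasure]
  congr 1
  funext s
  rw [intervalIntegral_eq_integral_unitMeasure]
  have : Function.Periodic (fun r => F (y s - y r)) 1 := fun r => by
    change F (y s - y (r + 1)) = F (y s - y r)
    rw [hy r]
  exact (integral_comp_add_of_periodic this s).symm

lemma sub_ne_zero_of_le {y : ℝ → E} {c : ℝ} (hc : 0 < c)
    (hlow : ∀ s, ∀ u ∈ Set.Ioo (0 : ℝ) 1, c * min u (1 - u) ≤ ‖y s - y (s + u)‖)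
    (s : ℝ) {u : ℝ} (hu : u ∈ Set.Ioo (0 : ℝ) 1) : y s - y (s + u) ≠ 0 :=
  norm_pos_iff.mp ((mul_pos hc (min_self_one_sub_pos hu)).trans_le (hlow s u hu))

lemma sub_ne_zero_of_le' {y : ℝ → E} {c : ℝ} (hc : 0 < c)
    (hlow : ∀ s, ∀ u ∈ Set.Ioo (0 : ℝ) 1, c * min u (1 - u) ≤ ‖y s - y (s + u)‖)
    (s : ℝ) {u : ℝ} (hu : u ∈ Set.Ioo (0 : ℝ) 1) : y s - y (s - u) ≠ 0 := by
  have := sub_ne_zero_of_le hc hlow (s - u) hu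
  rw [sub_add_cancel] at this
  rwa [← neg_sub, neg_ne_zero]

variable [InnerProductSpace ℝ E]

lemma symKernel_one_sub {y : ℝ → E} (hy : Function.Periodic y 1) (σ s u : ℝ) :
    symKernel σ y s (1 - u) = symKernel σ y s u := by
  rw [symKernel, symKernel, show s + (1 - u) = s - u + 1 by ring, hy,
    show s - (1 - u) = s + u - 1 by ring, hy.sub_eq, add_comm]

lemma periodic_symKernel {y : ℝ → E} (hy : Function.Periodic y 1) (σ u : ℝ) :
    Function.Periodic (fun s => symKernel σ y s u) 1 := fun s => by
  change symKernel σ y (s + 1) u = symKernel σ y s u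
  rw [symKernel, symKernel, hy, add_right_comm, hy, add_sub_right_comm, hy]

lemma exists_norm_symKernel_le {σ : ℝ} (hσ0 : 0 < σ) {y : ℝ → E}
    (hy : Function.Periodic y 1) (hC2 : ContDiff ℝ 2 y) {c : ℝ} (hc : 0 < c)
    (hlow : ∀ s, ∀ u ∈ Set.Ioo (0 : ℝ) 1, c * min u (1 - u) ≤ ‖y s - y (s + u)‖) :
    ∃ C, ∀ s, ∀ u ∈ Set.Ioo (0 : ℝ) 1, ‖symKernel σ y s u‖ ≤ C * (min u (1 - u)) ^ (-σ) := by
  obtain ⟨B, hB, hsec⟩ := exists_second_diff_le hy hC2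
  have key : ∀ s u, 0 < u → u ≤ 1 / 2 →
      ‖symKernel σ y s u‖ ≤ σ * (3 + σ) * c ^ (-(2 + σ)) * B * u ^ (-σ) := by
    intro s u hu hu2
    have hmin : min u (1 - u) = u := min_eq_left (by linarith)
    have h1 := hlow s u ⟨hu, by linarith⟩
    have h2 := hlow (s - u) u ⟨hu, by linarith⟩
    rw [hmin] at h1 h2
    rw [sub_add_cancel] at h2
    have h3 := norm_gradKernel_sub_le hσ0 (mul_pos hc hu) h1 h2
    have h4 : symKernel σ y s u =
        gradKernel σ (y s - y (s + u)) - gradKernel σ (y (s - u) - y s) := by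
      rw [symKernel, ← neg_sub (y (s - u)) (y s), gradKernel_neg, ← sub_eq_add_neg]
    rw [h4]
    refine h3.trans ?_
    calc _ ≤ σ * (3 + σ) * (c * u) ^ (-(2 + σ)) * (B * u ^ 2) := by
          gcongr
          exact hsec s u hu.le
      _ = σ * (3 + σ) * c ^ (-(2 + σ)) * B * (u ^ (-(2 + σ)) * u ^ (2 : ℝ)) := by
          rw [mul_rpow hc.le hu.le, rpow_two]; ring
      _ = _ := by
          rw [← rpow_add hu]; congr 2; ring
  refine ⟨σ * (3 + σ) * c ^ (-(2 + σ)) * B, fun s u hu => ?_⟩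
  rcases le_total u (1 / 2) with h | h
  · rw [min_eq_left (by linarith)]
    exact key s u hu.1 h
  · rw [min_eq_right (by linarith), ← symKernel_one_sub hy]
    exact key s (1 - u) (by linarith [hu.2]) (by linarith)

/-- The principal value integral is an absolutely convergent integral of the symmetrized
kernel. -/
lemma principalValue_eq [CompleteSpace E] {σ C c : ℝ} (hσ1 : σ < 1)
    {y : ℝ → E}
    (hy : Function.Periodic y 1) (hyc : Continuous y) (hc : 0 < c)
    (hlow : ∀ s, ∀ u ∈ Set.Ioo (0 : ℝ) 1, c * min u (1 - u) ≤ ‖y s - y (s + u)‖)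
    (hC : ∀ s, ∀ u ∈ Set.Ioo (0 : ℝ) 1, ‖symKernel σ y s u‖ ≤ C * (min u (1 - u)) ^ (-σ))
    {s : ℝ} {l : E}
    (hl : Tendsto (fun δ : ℝ => ∫ r in (s + δ)..(1 + s - δ), gradKernel σ (y s - y r))
      (𝓝[>] (0 : ℝ)) (𝓝 l)) :
    l = (1 / 2 : ℝ) • ∫ u, symKernel σ y s u ∂unitMeasure := by
  have hcont1 : ContinuousOn (fun u => gradKernel σ (y s - y (s + u))) (Set.Ioo 0 1) :=
    fun u hu => ((continuousAt_gradKernel σ (sub_ne_zero_of_le hc hlow s hu)).comp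
      (f := fun u => y s - y (s + u)) (by fun_prop)).continuousWithinAt
  have hcont2 : ContinuousOn (fun u => gradKernel σ (y s - y (s - u))) (Set.Ioo 0 1) :=
    fun u hu => ((continuousAt_gradKernel σ (sub_ne_zero_of_le' hc hlow s hu)).comp
      (f := fun u => y s - y (s - u)) (by fun_prop)).continuousWithinAt
  have hInt : Integrable (symKernel σ y s) unitMeasure := by
    refine Integrable.mono' ((integrable_min_rpow hσ1).const_mul C)
      ((hcont1.add hcont2).aestronglyMeasurable measurableSet_Ioo) ?_
    filter_upwards [ae_restrict_mem measurableSet_Ioo] with u hu using hC s u hu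
  have hcover : AECover unitMeasure (𝓝[>] (0 : ℝ)) fun δ : ℝ => Set.Ioc δ (1 - δ) := by
    apply aecover_Ioo_of_Ioc
    · exact tendsto_id.mono_left nhdsWithin_le_nhds
    · have : Tendsto (fun δ : ℝ => 1 - δ) (𝓝 0) (𝓝 (1 - 0)) :=
        (continuous_const.sub continuous_id).tendsto 0
      rw [sub_zero] at this
      exact this.mono_left nhdsWithin_le_nhds
  have hlim := (hcover.integral_tendsto_of_countably_generated hInt).const_smul (1 / 2 : ℝ)
  refine tendsto_nhds_unique hl (hlim.congr' ?_)
  have hδ : ∀ᶠ δ : ℝ in 𝓝[>] (0 : ℝ), δ ∈ Set.Ioo (0 : ℝ) (1 / 2) :=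
    Ioo_mem_nhdsGT (by norm_num)
  filter_upwards [hδ] with δ hδ
  have hsub : Set.Icc δ (1 - δ) ⊆ Set.Ioo 0 1 := fun x hx =>
    ⟨hδ.1.trans_le hx.1, by linarith [hx.2, hδ.1]⟩
  have hle : δ ≤ 1 - δ := by linarith [hδ.2]
  rw [Measure.restrict_restrict measurableSet_Ioc,
    Set.inter_eq_left.mpr (Set.Ioc_subset_Icc_self.trans hsub),
    ← intervalIntegral.integral_of_le hle]
  have i1 : IntervalIntegrable (fun u => gradKernel σ (y s - y (s + u))) volume δ (1 - δ) :=
    (hcont1.mono hsub).intervalIntegrable_of_Icc hle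
  have i2 : IntervalIntegrable (fun u => gradKernel σ (y s - y (s - u))) volume δ (1 - δ) :=
    (hcont2.mono hsub).intervalIntegrable_of_Icc hle
  have e1 : ∫ r in (s + δ)..(1 + s - δ), gradKernel σ (y s - y r) =
      ∫ u in δ..(1 - δ), gradKernel σ (y s - y (s + u)) := by
    rw [intervalIntegral.integral_comp_add_left (fun r => gradKernel σ (y s - y r)) s]
    congr 1; ring
  have e2 : ∫ u in δ..(1 - δ), gradKernel σ (y s - y (s - u)) =
      ∫ u in δ..(1 - δ), gradKernel σ (y s - y (s + u)) := by
    have := intervalIntegral.integral_comp_sub_left (a := δ) (b := 1 - δ)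
      (fun u => gradKernel σ (y s - y (s + u))) 1
    rw [sub_sub_cancel] at this
    rw [← this]
    congr 1
    funext u
    rw [show s + (1 - u) = s - u + 1 by ring, hy]
  have e3 : ∫ u in δ..(1 - δ), symKernel σ y s u =
      (∫ u in δ..(1 - δ), gradKernel σ (y s - y (s + u))) +
      ∫ u in δ..(1 - δ), gradKernel σ (y s - y (s - u)) :=
    intervalIntegral.integral_add i1 i2
  rw [e3, e2, e1]
  module

lemma continuous_integral_symKernel [MeasurableSpace E] [BorelSpace E]
    [SecondCountableTopology E] {σ C c : ℝ} (hσ1 : σ < 1)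
    {y : ℝ → E} (hyc : Continuous y) (hc : 0 < c)
    (hlow : ∀ s, ∀ u ∈ Set.Ioo (0 : ℝ) 1, c * min u (1 - u) ≤ ‖y s - y (s + u)‖)
    (hC : ∀ s, ∀ u ∈ Set.Ioo (0 : ℝ) 1, ‖symKernel σ y s u‖ ≤ C * (min u (1 - u)) ^ (-σ)) :
    Continuous fun s => ∫ u, symKernel σ y s u ∂unitMeasure := by
  have hm := measurable_gradKernel (E := E) σ
  refine continuous_of_dominated (bound := fun u => C * (min u (1 - u)) ^ (-σ)) ?_ ?_
    ((integrable_min_rpow hσ1).const_mul C) ?_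
  · intro s
    apply Measurable.aestronglyMeasurable
    unfold symKernel
    have := hyc.measurable
    fun_prop
  · intro s
    filter_upwards [ae_restrict_mem measurableSet_Ioo] with u hu using hC s u hu
  · filter_upwards [ae_restrict_mem measurableSet_Ioo] with u hu
    rw [continuous_iff_continuousAt]
    intro s
    exact ((continuousAt_gradKernel σ (sub_ne_zero_of_le hc hlow s hu)).comp
      (f := fun s => y s - y (s + u)) (by fun_prop)).add
      ((continuousAt_gradKernel σ (sub_ne_zero_of_le' hc hlow s hu)).comp
      (f := fun s => y s - y (s - u)) (by fun_prop))

end Energy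

section Variation

variable {E : Type*} [NormedAddCommGroup E] [InnerProductSpace ℝ E]

lemma integrable_unitMeasure_of_continuous {F : Type*} [NormedAddCommGroup F] {f : ℝ → F}
    (hf : Continuous f) : Integrable f unitMeasure :=
  ((hf.integrableOn_Icc (a := 0) (b := 1)).mono_set Set.Ioo_subset_Icc_self)

lemma hasDerivAt_kinetic (v : ℝ) {y z : ℝ → E} (hy : ContDiff ℝ 2 y) (hz : ContDiff ℝ 2 z)
    (hyp : Function.Periodic y 1) (hzp : Function.Periodic z 1) :
    HasDerivAt
      (fun ε : ℝ => ∫ s in (0 : ℝ)..1, v ^ 2 / 2 * ‖deriv (fun t => y t + ε • z t) s‖ ^ 2)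
      (-∫ s, inner ℝ (v ^ 2 • deriv (deriv y) s) (z s) ∂unitMeasure) 0 := by
  have hyd : Differentiable ℝ y := hy.differentiable two_ne_zero
  have hzd : Differentiable ℝ z := hz.differentiable two_ne_zero
  have hy1 : ContDiff ℝ 1 (deriv y) := contDiff_one_deriv hy
  have hyc : Continuous (deriv y) := hy1.continuous
  have hzc : Continuous (deriv z) := hz.continuous_deriv (by norm_num)
  have hyc2 : Continuous (deriv (deriv y)) := hy1.continuous_deriv le_rfl
  have hdd : Differentiable ℝ (deriv y) := hy1.differentiable one_ne_zero
  have hcongr : ∀ ε : ℝ,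
      ∫ s in (0 : ℝ)..1, v ^ 2 / 2 * ‖deriv (fun t => y t + ε • z t) s‖ ^ 2 =
      v ^ 2 / 2 * (∫ s in (0 : ℝ)..1, ‖deriv y s‖ ^ 2) +
        (v ^ 2 * ∫ s in (0 : ℝ)..1, inner ℝ (deriv y s) (deriv z s)) * ε +
        v ^ 2 / 2 * (∫ s in (0 : ℝ)..1, ‖deriv z s‖ ^ 2) * ε ^ 2 := by
    intro ε
    have h1 : ∀ s, v ^ 2 / 2 * ‖deriv (fun t => y t + ε • z t) s‖ ^ 2 =
        v ^ 2 / 2 * ‖deriv y s‖ ^ 2 + (v ^ 2 * ε) * inner ℝ (deriv y s) (deriv z s) +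
        (v ^ 2 / 2 * ε ^ 2) * ‖deriv z s‖ ^ 2 := by
      intro s
      have hd : deriv (fun t => y t + ε • z t) s = deriv y s + ε • deriv z s :=
        ((hyd s).hasDerivAt.add ((hzd s).hasDerivAt.const_smul ε)).deriv
      rw [hd, norm_add_sq_real, inner_smul_right, norm_smul, mul_pow, Real.norm_eq_abs, sq_abs]
      ring
    simp_rw [h1]
    rw [intervalIntegral.integral_add, intervalIntegral.integral_add,
      intervalIntegral.integral_const_mul, intervalIntegral.integral_const_mul,
      intervalIntegral.integral_const_mul]
    · ring
    all_goals exact Continuous.intervalIntegrable (by fun_prop) _ _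
  have hparts : ∫ s in (0 : ℝ)..1, inner ℝ (deriv y s) (deriv z s) =
      -∫ s in (0 : ℝ)..1, inner ℝ (deriv (deriv y) s) (z s) := by
    have h2 : ∀ x ∈ Set.uIcc (0 : ℝ) 1, HasDerivAt (fun s => inner ℝ (deriv y s) (z s))
        (inner ℝ (deriv y x) (deriv z x) + inner ℝ (deriv (deriv y) x) (z x)) x :=
      fun x _ => (hdd x).hasDerivAt.inner ℝ (hzd x).hasDerivAt
    have hzc0 := hz.continuous
    have h3 := intervalIntegral.integral_eq_sub_of_hasDerivAt h2
      (Continuous.intervalIntegrable (by fun_prop) _ _)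
    rw [intervalIntegral.integral_add (Continuous.intervalIntegrable (by fun_prop) _ _)
      (Continuous.intervalIntegrable (by fun_prop) _ _)] at h3
    have h4 := periodic_deriv hyp 0
    have h5 := hzp 0
    rw [zero_add] at h4 h5
    rw [h4, h5, sub_self] at h3
    linarith
  rw [funext hcongr]
  have h6 := (((hasDerivAt_id (0 : ℝ)).const_mul
    (v ^ 2 * ∫ s in (0 : ℝ)..1, inner ℝ (deriv y s) (deriv z s))).const_add
    (v ^ 2 / 2 * (∫ s in (0 : ℝ)..1, ‖deriv y s‖ ^ 2))).add
    (((hasDerivAt_id (0 : ℝ)).pow 2).const_mul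
      (v ^ 2 / 2 * (∫ s in (0 : ℝ)..1, ‖deriv z s‖ ^ 2)))
  refine h6.congr_deriv ?_
  simp_rw [inner_smul_left]
  rw [MeasureTheory.integral_const_mul, ← intervalIntegral_eq_integral_unitMeasure, hparts]
  simp

variable [MeasurableSpace E] [BorelSpace E] [SecondCountableTopology E]

lemma hasDerivAt_potential {σ c : ℝ} (hσ0 : 0 < σ) (hσ1 : σ < 1) {y z : ℝ → E}
    (hyp : Function.Periodic y 1) (hzp : Function.Periodic z 1)
    (hy : Continuous y) (hz : ContDiff ℝ 1 z) (hc : 0 < c)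
    (hlow : ∀ s, ∀ u ∈ Set.Ioo (0 : ℝ) 1, c * min u (1 - u) ≤ ‖y s - y (s + u)‖) :
    Integrable (fun p : ℝ × ℝ =>
        -inner ℝ (gradKernel σ (y p.1 - y (p.1 + p.2))) (z p.1 - z (p.1 + p.2)))
      (unitMeasure.prod unitMeasure) ∧
    HasDerivAt
      (fun ε : ℝ => ∫ s in (0 : ℝ)..1, ∫ r in (0 : ℝ)..1,
        ‖(y s + ε • z s) - (y r + ε • z r)‖ ^ (-σ))
      (∫ p, -inner ℝ (gradKernel σ (y p.1 - y (p.1 + p.2))) (z p.1 - z (p.1 + p.2))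
        ∂(unitMeasure.prod unitMeasure)) 0 := by
  obtain ⟨M, hM, hup⟩ := exists_norm_sub_le_min hzp hz
  have hzm : Measurable z := hz.continuous.measurable
  have hym : Measurable y := hy.measurable
  have hκ := measurable_gradKernel (E := E) σ
  set W : ℝ → ℝ × ℝ → E :=
    fun ε p => (y p.1 - y (p.1 + p.2)) + ε • (z p.1 - z (p.1 + p.2)) with hW
  set R : ℝ := c / (2 * M) with hR
  have hR0 : 0 < R := by positivity
  have hWlow : ∀ ε ∈ Metric.ball (0 : ℝ) R, ∀ s, ∀ u ∈ Set.Ioo (0 : ℝ) 1,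
      c / 2 * min u (1 - u) ≤ ‖W ε (s, u)‖ := by
    intro ε hε s u hu
    have hm := min_self_one_sub_pos hu
    have h1 := hlow s u hu
    have h2 := hup s u hu
    rw [mem_ball_zero_iff] at hε
    have h3 : ‖ε • (z s - z (s + u))‖ ≤ c / 2 * min u (1 - u) := by
      rw [norm_smul]
      calc ‖ε‖ * ‖z s - z (s + u)‖ ≤ R * (M * min u (1 - u)) := by gcongr
        _ = c / 2 * min u (1 - u) := by rw [hR]; field_simp
    have h4 := norm_sub_le_norm_add (y s - y (s + u)) (ε • (z s - z (s + u)))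
    simp only [hW]
    linarith
  have hbound : ∀ ε ∈ Metric.ball (0 : ℝ) R, ∀ s, ∀ u ∈ Set.Ioo (0 : ℝ) 1,
      ‖-inner ℝ (gradKernel σ (W ε (s, u))) (z s - z (s + u))‖ ≤
        σ * (c / 2) ^ (-(1 + σ)) * M * (min u (1 - u)) ^ (-σ) := by
    intro ε hε s u hu
    have hm := min_self_one_sub_pos hu
    rw [norm_neg]
    refine (norm_inner_gradKernel_le hσ0 (by positivity) (hWlow ε hε s u hu) _).trans ?_
    calc σ * (c / 2 * min u (1 - u)) ^ (-(1 + σ)) * ‖z s - z (s + u)‖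
        ≤ σ * (c / 2 * min u (1 - u)) ^ (-(1 + σ)) * (M * min u (1 - u)) := by
          gcongr
          exact hup s u hu
      _ = σ * (c / 2) ^ (-(1 + σ)) * M *
          ((min u (1 - u)) ^ (-(1 + σ)) * (min u (1 - u)) ^ (1 : ℝ)) := by
          rw [mul_rpow (by positivity) hm.le, rpow_one]; ring
      _ = _ := by
          rw [← rpow_add hm]; congr 2; ring
  have hmeas : ∀ ε, Measurable (W ε) := fun ε => by
    simp only [hW]
    fun_prop
  have hInt : ∀ ε ∈ Metric.ball (0 : ℝ) R,
      Integrable (fun p => ‖W ε p‖ ^ (-σ)) (unitMeasure.prod unitMeasure) := by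
    intro ε hε
    have := hmeas ε
    refine integrable_prod_of_norm_le_min_rpow (C := (c / 2) ^ (-σ)) hσ1
      (Measurable.aestronglyMeasurable (by fun_prop)) fun s u hu => ?_
    have hm := min_self_one_sub_pos hu
    rw [Real.norm_of_nonneg (by positivity), ← mul_rpow (by positivity) hm.le]
    exact rpow_le_rpow_of_nonpos (by positivity) (hWlow ε hε s u hu) (by linarith)
  have hmain := hasDerivAt_integral_of_dominated_loc_of_deriv_le
    (μ := unitMeasure.prod unitMeasure) (F := fun ε p => ‖W ε p‖ ^ (-σ))
    (F' := fun ε p => -inner ℝ (gradKernel σ (W ε p)) (z p.1 - z (p.1 + p.2)))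
    (bound := fun p => σ * (c / 2) ^ (-(1 + σ)) * M * (min p.2 (1 - p.2)) ^ (-σ))
    (x₀ := 0) (s := Metric.ball 0 R) (Metric.ball_mem_nhds 0 hR0) ?_
    (hInt 0 (Metric.mem_ball_self hR0)) ?_ ?_ ?_ ?_
  · have hW0 : W 0 = fun p => y p.1 - y (p.1 + p.2) := by
      funext p
      simp [hW]
    simp only [hW0] at hmain
    refine ⟨hmain.1, hmain.2.congr_of_eventuallyEq ?_⟩
    filter_upwards [Metric.ball_mem_nhds (0 : ℝ) hR0] with ε hε
    rw [integral_prod _ (hInt ε hε)]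
    have hp : Function.Periodic (fun t => y t + ε • z t) 1 := fun t => by
      change y (t + 1) + ε • z (t + 1) = y t + ε • z t
      rw [hyp, hzp]
    rw [double_integral_eq_of_periodic hp (fun w => ‖w‖ ^ (-σ))]
    congr 1; funext s
    congr 1; funext u
    simp only [hW]
    congr 2
    module
  · refine Eventually.of_forall fun ε => Measurable.aestronglyMeasurable ?_
    have := hmeas ε
    fun_prop
  · apply Measurable.aestronglyMeasurable
    have := hmeas 0
    fun_prop
  · filter_upwards [ae_unitMeasure_prod_mem] with p hp ε hε
    exact hbound ε hε p.1 p.2 hp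
  · exact ((integrable_min_rpow hσ1).const_mul _).comp_snd unitMeasure
  · filter_upwards [ae_unitMeasure_prod_mem] with p hp ε hε
    apply hasDerivAt_norm_add_smul_rpow
    have hm := min_self_one_sub_pos hp
    exact norm_pos_iff.mp (lt_of_lt_of_le (by positivity) (hWlow ε hε p.1 p.2 hp))

lemma integral_inner_gradKernel_eq [CompleteSpace E] {σ C c : ℝ} (hσ1 : σ < 1) {y z : ℝ → E}
    (hyp : Function.Periodic y 1) (hzp : Function.Periodic z 1)
    (hy : Continuous y) (hz : Continuous z) (hc : 0 < c)
    (hlow : ∀ s, ∀ u ∈ Set.Ioo (0 : ℝ) 1, c * min u (1 - u) ≤ ‖y s - y (s + u)‖)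
    (hC : ∀ s, ∀ u ∈ Set.Ioo (0 : ℝ) 1, ‖symKernel σ y s u‖ ≤ C * (min u (1 - u)) ^ (-σ))
    (hInt : Integrable (fun p : ℝ × ℝ =>
        -inner ℝ (gradKernel σ (y p.1 - y (p.1 + p.2))) (z p.1 - z (p.1 + p.2)))
      (unitMeasure.prod unitMeasure)) :
    ∫ p, -inner ℝ (gradKernel σ (y p.1 - y (p.1 + p.2))) (z p.1 - z (p.1 + p.2))
        ∂(unitMeasure.prod unitMeasure) =
      -∫ s, inner ℝ (∫ u, symKernel σ y s u ∂unitMeasure) (z s) ∂unitMeasure := by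
  have hzm : Measurable z := hz.measurable
  have hym : Measurable y := hy.measurable
  have hκ := measurable_gradKernel (E := E) σ
  obtain ⟨M, hM, hzM⟩ := exists_norm_le_of_periodic hzp hz
  have hsymm : Measurable fun p : ℝ × ℝ => symKernel σ y p.1 p.2 := by
    unfold symKernel
    fun_prop
  have hInt2 : Integrable (fun p : ℝ × ℝ => inner ℝ (symKernel σ y p.1 p.2) (z p.1))
      (unitMeasure.prod unitMeasure) := by
    refine integrable_prod_of_norm_le_min_rpow (C := C * M) hσ1
      (Measurable.aestronglyMeasurable (by fun_prop)) fun s u hu => ?_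
    refine (norm_inner_le_norm _ _).trans ?_
    have h1 := hC s u hu
    calc _ ≤ (C * (min u (1 - u)) ^ (-σ)) * M := by
          gcongr
          · exact (norm_nonneg _).trans h1
          · exact hzM s
      _ = _ := by ring
  have hInt3 : Integrable (fun p : ℝ × ℝ => symKernel σ y p.1 p.2)
      (unitMeasure.prod unitMeasure) :=
    integrable_prod_of_norm_le_min_rpow hσ1 hsymm.aestronglyMeasurable hC
  have hslice : ∀ u ∈ Set.Ioo (0 : ℝ) 1,
      ∫ s, -inner ℝ (gradKernel σ (y s - y (s + u))) (z s - z (s + u)) ∂unitMeasure =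
      -∫ s, inner ℝ (symKernel σ y s u) (z s) ∂unitMeasure := by
    intro u hu
    have hc1 : Continuous fun s => gradKernel σ (y s - y (s + u)) :=
      continuous_iff_continuousAt.mpr fun s =>
        (continuousAt_gradKernel σ (sub_ne_zero_of_le hc hlow s hu)).comp
          (f := fun s => y s - y (s + u)) (by fun_prop)
    have hc2 : Continuous fun s => gradKernel σ (y s - y (s - u)) :=
      continuous_iff_continuousAt.mpr fun s =>
        (continuousAt_gradKernel σ (sub_ne_zero_of_le' hc hlow s hu)).comp
          (f := fun s => y s - y (s - u)) (by fun_prop)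
    set g : ℝ → ℝ := fun s => inner ℝ (gradKernel σ (y s - y (s - u))) (z s) with hg
    have hgp : Function.Periodic g 1 := fun s => by
      simp only [hg]
      rw [hyp, hzp, add_sub_right_comm, hyp]
    have hshift := integral_comp_add_of_periodic hgp u
    have e1 : ∀ s, -inner ℝ (gradKernel σ (y s - y (s + u))) (z s - z (s + u)) =
        -inner ℝ (gradKernel σ (y s - y (s + u))) (z s) + -g (u + s) := by
      intro s
      simp only [hg]
      rw [add_sub_cancel_left, add_comm u s, ← neg_sub (y s) (y (s + u)), gradKernel_neg,
        inner_sub_right, inner_neg_left]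
      ring
    have hgc : Continuous g := by fun_prop
    simp_rw [e1]
    rw [integral_add (integrable_unitMeasure_of_continuous (by fun_prop))
        (integrable_unitMeasure_of_continuous (by fun_prop)),
        MeasureTheory.integral_neg, MeasureTheory.integral_neg,
      hshift, ← neg_add,
      ← integral_add (integrable_unitMeasure_of_continuous (by fun_prop))
        (integrable_unitMeasure_of_continuous (by fun_prop))]
    simp only [hg, symKernel, inner_add_left]
  rw [integral_prod_symm _ hInt]
  calc _ = ∫ u, -∫ s, inner ℝ (symKernel σ y s u) (z s) ∂unitMeasure ∂unitMeasure :=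
        setIntegral_congr_fun measurableSet_Ioo hslice
    _ = -∫ s, ∫ u, inner ℝ (symKernel σ y s u) (z s) ∂unitMeasure ∂unitMeasure := by
        rw [MeasureTheory.integral_neg, ← integral_prod_symm _ hInt2, integral_prod _ hInt2]
    _ = _ := by
        congr 1
        refine integral_congr_ae ?_
        filter_upwards [hInt3.prod_right_ae] with s hs
        simp_rw [real_inner_comm (z s)]
        exact integral_inner hs (z s)

end Variation

section FundamentalLemma

variable {E : Type*} [NormedAddCommGroup E] [InnerProductSpace ℝ E]

/-- The fundamental lemma of the calculus of variations for periodic functions. -/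
lemma eq_zero_of_integral_inner_periodic_eq_zero {h : ℝ → E} (hp : Function.Periodic h 1)
    (hc : Continuous h)
    (H : ∀ z : ℝ → E, Function.Periodic z 1 → ContDiff ℝ 2 z →
      ∫ s, inner ℝ (h s) (z s) ∂unitMeasure = 0) (s : ℝ) : h s = 0 := by
  by_contra hs
  have hpos : 0 < inner ℝ (h s) (h s) := real_inner_self_pos.mpr hs
  have hcont : Continuous fun t => inner ℝ (h t) (h s) := by fun_prop
  obtain ⟨δ, hδ, hball⟩ := Metric.eventually_nhds_iff.mp
    (hcont.continuousAt.eventually (lt_mem_nhds hpos))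
  set η := min δ (1 / 4) with hη
  have hη0 : 0 < η := by positivity
  have hη1 : η ≤ 1 / 4 := min_le_right _ _
  set ψ : ℝ → ℝ := fun t => Real.smoothTransition (cos (2 * π * (t - s)) - cos (2 * π * η))
    with hψ
  have hψc : ContDiff ℝ 2 ψ := by
    have : ContDiff ℝ 2 fun t => cos (2 * π * (t - s)) - cos (2 * π * η) := by fun_prop
    exact Real.smoothTransition.contDiff.comp this
  have hψp : Function.Periodic ψ 1 := fun t => by
    simp only [hψ]
    rw [show 2 * π * (t + 1 - s) = 2 * π * (t - s) + 2 * π by ring, cos_add_two_pi]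
  have hzero := H (fun t => ψ t • h s)
    (fun t => by change ψ (t + 1) • h s = ψ t • h s; rw [hψp])
    (hψc.smul contDiff_const)
  set f : ℝ → ℝ := fun t => inner ℝ (h t) (ψ t • h s) with hf
  have hfp : Function.Periodic f 1 := fun t => by simp only [hf]; rw [hψp, hp]
  have hψc0 := hψc.continuous
  have hfc : Continuous f := by fun_prop
  rw [← intervalIntegral_eq_integral_unitMeasure] at hzero
  have hshift := hfp.intervalIntegral_add_eq 0 (s - 1 / 2)
  rw [zero_add, hzero] at hshift
  refine hshift.not_lt (intervalIntegral.integral_pos (by linarith) hfc.continuousOn ?_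
    ⟨s, ⟨by linarith, by linarith⟩, ?_⟩)
  · intro t ht
    simp only [hf, inner_smul_right]
    by_cases hd : |t - s| < η
    · refine mul_nonneg (Real.smoothTransition.nonneg _) (hball ?_).le
      exact hd.trans_le (min_le_left _ _)
    · have : ψ t = 0 := by
        apply Real.smoothTransition.zero_of_nonpos
        rw [sub_nonpos, ← cos_abs, abs_mul, abs_of_pos two_pi_pos]
        have habs : |t - s| ≤ 1 / 2 := abs_le.mpr ⟨by linarith [ht.1], by linarith [ht.2]⟩
        apply cos_le_cos_of_nonneg_of_le_pi
        · positivity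
        · nlinarith [pi_pos]
        · have := not_lt.mp hd
          gcongr
      rw [this, zero_mul]
  · simp only [hf, inner_smul_right]
    refine mul_pos (Real.smoothTransition.pos_of_pos ?_) hpos
    rw [sub_self, mul_zero, cos_zero, sub_pos, ← cos_zero]
    apply cos_lt_cos_of_nonneg_of_le_pi le_rfl
    · nlinarith [pi_pos]
    · positivity

end FundamentalLemma

/-- A 1-periodic C² regular simple closed curve `y` is an extremal of the
action `𝒜^σ` (the derivative at `ε = 0` of `ε ↦ 𝒜^σ(y + εz)` vanishes for every
1-periodic C² variation `z`) if and only if for all `s`,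
`v² ÿ(s) = −lim_{δ→0⁺} ∫_{s+δ}^{1+s−δ} σ(y(s) − y(r))/‖y(s) − y(r)‖^{2+σ} dr`,
where `L s` denotes that principal-value limit. -/
theorem extremal_iff_equation (d : ℕ) (σ v : ℝ) (hσ0 : 0 < σ) (hσ1 : σ < 1)
    (hv : 0 < v)
    (y : ℝ → EuclideanSpace ℝ (Fin d))
    (hper : Function.Periodic y 1)
    (hC2 : ContDiff ℝ 2 y)
    (hreg : ∀ s : ℝ, deriv y s ≠ 0)
    (hinj : Set.InjOn y (Set.Ico (0 : ℝ) 1))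
    (L : ℝ → EuclideanSpace ℝ (Fin d))
    (hL : ∀ s : ℝ,
      Tendsto
        (fun δ : ℝ => ∫ r in (s + δ)..(1 + s - δ),
          (σ / ‖y s - y r‖ ^ (2 + σ)) • (y s - y r))
        (𝓝[>] (0 : ℝ)) (𝓝 (L s))) :
    (∀ z : ℝ → EuclideanSpace ℝ (Fin d), Function.Periodic z 1 → ContDiff ℝ 2 z →
        deriv (fun ε : ℝ => actionA d σ v (fun t => y t + ε • z t)) 0 = 0) ↔
      ∀ s : ℝ, v ^ 2 • deriv (deriv y) s = -L s := by
  have hyc : Continuous y := hC2.continuous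
  have hy1 : ContDiff ℝ 1 (deriv y) := contDiff_one_deriv hC2
  have hyc2 : Continuous (deriv (deriv y)) := hy1.continuous_deriv le_rfl
  obtain ⟨c, hc, hlow⟩ := exists_le_norm_sub hper (hC2.of_le (by norm_num)) hreg hinj
  obtain ⟨C, hC⟩ := exists_norm_symKernel_le hσ0 hper hC2 hc hlow
  have hLeq : ∀ s, L s = (1 / 2 : ℝ) • ∫ u, symKernel σ y s u ∂unitMeasure := fun s =>
    principalValue_eq hσ1 hper hyc hc hlow hC (hL s)
  have hLc : Continuous L := by
    rw [funext hLeq]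
    exact (continuous_integral_symKernel hσ1 hyc hc hlow hC).const_smul (1 / 2 : ℝ)
  have hLp : Function.Periodic L 1 := fun s => by
    rw [hLeq, hLeq]
    congr 2
    funext u
    exact periodic_symKernel hper σ u s
  have hderiv : ∀ z : ℝ → EuclideanSpace ℝ (Fin d), Function.Periodic z 1 → ContDiff ℝ 2 z →
      deriv (fun ε : ℝ => actionA d σ v (fun t => y t + ε • z t)) 0 =
        -∫ s, inner ℝ (v ^ 2 • deriv (deriv y) s + L s) (z s) ∂unitMeasure := by
    intro z hzp hz
    have hzc := hz.continuous
    obtain ⟨hInt, hpot⟩ := hasDerivAt_potential hσ0 hσ1 hper hzp hyc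
      (hz.of_le (by norm_num)) hc hlow
    rw [integral_inner_gradKernel_eq hσ1 hper hzp hyc hzc hc hlow hC hInt] at hpot
    have hD := (hasDerivAt_kinetic v hC2 hz hper hzp).add (hpot.const_mul (1 / 2))
    have hI : ∀ s, ∫ u, symKernel σ y s u ∂unitMeasure = (2 : ℝ) • L s := fun s => by
      rw [hLeq]; module
    unfold actionA
    refine hD.deriv.trans ?_
    simp_rw [hI, inner_add_left]
    rw [integral_add (integrable_unitMeasure_of_continuous (by fun_prop))
      (integrable_unitMeasure_of_continuous (by fun_prop))]
    simp_rw [inner_smul_left _ _ (2 : ℝ)]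
    rw [MeasureTheory.integral_const_mul]
    simp
    ring
  constructor
  · intro H s
    rw [eq_neg_iff_add_eq_zero]
    refine eq_zero_of_integral_inner_periodic_eq_zero
      (h := fun s => v ^ 2 • deriv (deriv y) s + L s) (fun s => ?_) (by fun_prop)
      (fun z hzp hz => ?_) s
    · change v ^ 2 • deriv (deriv y) (s + 1) + L (s + 1) = _
      rw [hLp, periodic_deriv (periodic_deriv hper)]
    · rw [← neg_eq_zero, ← hderiv z hzp hz]
      exact H z hzp hz
  · intro H z hzp hz
    rw [hderiv z hzp hz]
    simp [H]
end

section
/- Let 0 < σ < 1, c = ∫₀¹ (2 sin(πt))^{−σ} dt, and v² = σc/(8π²). Then for every 1-periodic function y : ℝ → ℝ^d with restriction to [0,1] in H¹ and ∫₀¹ y = 0, the action 𝒜^σ(y) = ∫₀¹ (v²/2)‖ẏ(s)‖² ds + (1/2)∫₀¹∫₀¹ ‖y(s) − y(r)‖^{−σ} dr ds satisfies 𝒜^σ(y) ≥ 2π²v²(1 + 2/σ). -/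
open MeasureTheory Real Filter Topology intervalIntegral

lemma abs_sin_nat_mul_le (n : ℕ) (x : ℝ) : |Real.sin (n * x)| ≤ n * |Real.sin x| := by
  induction n with
  | zero => simp
  | succ n ih =>
    push_cast
    rw [add_mul, one_mul, Real.sin_add]
    calc |Real.sin (n * x) * Real.cos x + Real.cos (n * x) * Real.sin x|
        ≤ |Real.sin (n * x)| * |Real.cos x| + |Real.cos (n * x)| * |Real.sin x| := by
          rw [← abs_mul, ← abs_mul]; exact abs_add_le _ _
      _ ≤ |Real.sin (n * x)| * 1 + 1 * |Real.sin x| := by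
          gcongr <;> exact Real.abs_cos_le_one _
      _ ≤ (n + 1) * |Real.sin x| := by linarith

lemma abs_sin_int_mul_le (n : ℤ) (x : ℝ) : |Real.sin (n * x)| ≤ |(n : ℝ)| * |Real.sin x| := by
  rcases Int.natAbs_eq n with h | h
  all_goals
    rw [h]
    push_cast
    simpa using abs_sin_nat_mul_le n.natAbs x

lemma ofReal_integral_le_lintegral_ofReal {α : Type*} [MeasurableSpace α] {μ : Measure α}
    (f : α → ℝ) : ENNReal.ofReal (∫ x, f x ∂μ) ≤ ∫⁻ x, ENNReal.ofReal (f x) ∂μ := by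
  by_cases hf : Integrable f μ
  · rw [integral_eq_lintegral_pos_part_sub_lintegral_neg_part hf]
    refine (ENNReal.ofReal_le_ofReal (sub_le_self _ ENNReal.toReal_nonneg)).trans ?_
    exact ENNReal.ofReal_toReal_le
  · simp [integral_undef hf]

lemma rpow_neg_ge_tangent {σ x a : ℝ} (hσ : 0 < σ) (hx : 0 < x) (ha : 0 < a) :
    a ^ (-σ) * (1 + σ / 2 - σ / 2 * (x ^ 2 / a ^ 2)) ≤ x ^ (-σ) := by
  have hxa : 0 < x / a := div_pos hx ha
  have h1 : x ^ (-σ) = a ^ (-σ) * (x / a) ^ (-σ) := by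
    rw [← Real.mul_rpow ha.le hxa.le, mul_div_cancel₀ _ ha.ne']
  rw [h1]
  gcongr
  have h2 := Real.log_le_sub_one_of_pos (pow_pos hxa 2)
  rw [Real.log_pow] at h2
  have h3 := Real.add_one_le_exp (Real.log (x / a) * (-σ))
  rw [Real.rpow_def_of_pos hxa, ← div_pow]
  push_cast at h2
  nlinarith

lemma ofReal_tangent_le_rpow_neg {σ x a : ℝ} (hσ : 0 < σ) (hx : 0 ≤ x) (ha : 0 < a) :
    ENNReal.ofReal (a ^ (-σ) * (1 + σ / 2 - σ / 2 * (x ^ 2 / a ^ 2))) ≤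
      ENNReal.ofReal x ^ (-σ) := by
  rcases hx.eq_or_lt with rfl | hx
  · simp [ENNReal.zero_rpow_of_neg (neg_lt_zero.2 hσ)]
  · rw [ENNReal.ofReal_rpow_of_pos hx]
    exact ENNReal.ofReal_le_ofReal (rpow_neg_ge_tangent hσ hx ha)

lemma norm_integral_exp_mul_sq_le {k : ℤ} (hk : k ≠ 0) (t : ℝ) :
    ‖∫ u in (0 : ℝ)..t, Complex.exp (2 * π * Complex.I * k * u)‖ ^ 2 ≤
      Real.sin (π * t) ^ 2 / π ^ 2 := by
  have hk' : (k : ℝ) ≠ 0 := by exact_mod_cast hk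
  have hc : (2 * π * Complex.I * k : ℂ) ≠ 0 := by
    have : (π : ℂ) ≠ 0 := by exact_mod_cast Real.pi_ne_zero
    have : (k : ℂ) ≠ 0 := by exact_mod_cast hk
    simp [*]
  rw [integral_exp_mul_complex hc, norm_div]
  have h1 : (2 * π * Complex.I * k * t : ℂ) = Complex.I * ((2 * π * k * t : ℝ) : ℂ) := by
    push_cast; ring
  rw [Complex.ofReal_zero, mul_zero, Complex.exp_zero, h1, Complex.norm_exp_I_mul_ofReal_sub_one]
  have h2 : ‖(2 * π * Complex.I * k : ℂ)‖ = 2 * π * |(k : ℝ)| := by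
    simp [abs_of_pos Real.pi_pos]
  have h3 : 2 * π * k * t / 2 = k * (π * t) := by ring
  rw [h2, h3, norm_mul, Real.norm_eq_abs, Real.norm_eq_abs, abs_two, ← sq_abs (Real.sin (π * t)),
    ← div_pow]
  have := abs_sin_int_mul_le k (π * t)
  have hkp : 0 < |(k : ℝ)| := abs_pos.2 hk'
  gcongr ?_ ^ 2
  rw [div_le_div_iff₀ (by positivity) Real.pi_pos]
  nlinarith [Real.pi_pos]

lemma continuous_integral_shift {h : ℝ → ℂ} (hint : ∀ a b, IntervalIntegrable h volume a b)
    (t : ℝ) : Continuous fun s : ℝ => ∫ u in (0 : ℝ)..t, h (s + u) := by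
  have hH := intervalIntegral.continuous_primitive hint 0
  have heq : (fun s : ℝ => ∫ u in (0 : ℝ)..t, h (s + u)) =
      fun s => (∫ u in (0 : ℝ)..(s + t), h u) - ∫ u in (0 : ℝ)..s, h u := by
    funext s
    rw [intervalIntegral.integral_comp_add_left (fun u => h u), add_zero,
      intervalIntegral.integral_interval_sub_left (hint _ _) (hint _ _)]
  rw [heq]
  exact (hH.comp (continuous_id.add continuous_const)).sub hH

lemma integral_exp_mul_integral_shift {h : ℝ → ℂ} (hper : Function.Periodic h 1)
    (hmeas : Measurable h) (hint : IntervalIntegrable h volume 0 1) (k : ℤ) (t : ℝ) :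
    ∫ s in (0 : ℝ)..1, Complex.exp (-(2 * π * Complex.I * k * s)) * ∫ u in (0 : ℝ)..t, h (s + u) =
      (∫ u in (0 : ℝ)..t, Complex.exp (2 * π * Complex.I * k * u)) *
        ∫ s in (0 : ℝ)..1, Complex.exp (-(2 * π * Complex.I * k * s)) * h s := by
  have hshift : ∀ u : ℝ, IntervalIntegrable (fun s => h (s + u)) volume 0 1 := fun u => by
    have := hper.intervalIntegrable₀ one_ne_zero hint (0 + u) (1 + u)
    simpa using this.comp_add_right u
  have hnorm : ∀ s : ℝ, ‖Complex.exp (-(2 * π * Complex.I * k * s))‖ = 1 := fun s => by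
    rw [Complex.norm_exp]; simp
  have hF : IntegrableOn (Function.uncurry fun s u : ℝ =>
      Complex.exp (-(2 * π * Complex.I * k * s)) * h (s + u))
      (Set.uIoc 0 1 ×ˢ Set.uIoc 0 t) := by
    have hFm : Measurable (Function.uncurry fun s u : ℝ =>
        Complex.exp (-(2 * π * Complex.I * k * s)) * h (s + u)) := by
      unfold Function.uncurry
      fun_prop
    rw [IntegrableOn, Measure.volume_eq_prod, ← Measure.prod_restrict,
      integrable_prod_iff' hFm.aestronglyMeasurable]
    simp only [Function.uncurry, norm_mul, hnorm, one_mul]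
    constructor
    · refine ae_of_all _ fun u => ?_
      refine ((hshift u).def'.norm).mono' (by fun_prop) (ae_of_all _ fun s => ?_)
      simp [hnorm]
    · have : (fun u : ℝ => ∫ s in Set.uIoc (0 : ℝ) 1, ‖h (s + u)‖) =
          fun _ => ∫ s in (0 : ℝ)..1, ‖h s‖ := by
        funext u
        rw [Set.uIoc_of_le zero_le_one, ← intervalIntegral.integral_of_le zero_le_one,
          intervalIntegral.integral_comp_add_right (fun s => ‖h s‖), zero_add, add_comm 1 u]
        have hp : Function.Periodic (fun s => ‖h s‖) 1 := fun s => by simp [hper s]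
        simpa using hp.intervalIntegral_add_eq u 0
      rw [this]
      exact (intervalIntegrable_const (a := 0) (b := t)).def'
  have hinner : ∀ s : ℝ,
      Complex.exp (-(2 * π * Complex.I * k * s)) * ∫ u in (0 : ℝ)..t, h (s + u) =
        ∫ u in (0 : ℝ)..t, Complex.exp (-(2 * π * Complex.I * k * s)) * h (s + u) :=
    fun s => (intervalIntegral.integral_const_mul _ _).symm
  simp_rw [hinner]
  rw [intervalIntegral_intervalIntegral_swap hF, ← intervalIntegral.integral_mul_const]
  refine intervalIntegral.integral_congr fun u _ => ?_
  set G : ℝ → ℂ := fun s => Complex.exp (-(2 * π * Complex.I * k * s)) * h s with hG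
  have hGper : Function.Periodic G 1 := fun s => by
    simp only [hG, hper s]
    congr 1
    rw [Complex.exp_eq_exp_iff_exists_int]
    exact ⟨-k, by push_cast; ring⟩
  calc ∫ s in (0 : ℝ)..1, Complex.exp (-(2 * π * Complex.I * k * s)) * h (s + u)
      = ∫ s in (0 : ℝ)..1, Complex.exp (2 * π * Complex.I * k * u) * G (s + u) := by
        refine intervalIntegral.integral_congr fun s _ => ?_
        simp only [hG]
        rw [← mul_assoc, ← Complex.exp_add]
        congr 2
        push_cast; ring
    _ = _ := by
        rw [intervalIntegral.integral_const_mul, intervalIntegral.integral_comp_add_right,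
          zero_add, add_comm 1 u, hGper.intervalIntegral_add_eq u 0, zero_add]

lemma hasSum_sq_norm_integral_exp_mul {f : ℝ → ℂ}
    (hf : MemLp f 2 (volume.restrict (Set.Ioc 0 1))) :
    HasSum (fun k : ℤ => ‖∫ s in (0 : ℝ)..1, Complex.exp (-(2 * π * Complex.I * k * s)) * f s‖ ^ 2)
      (∫ s in (0 : ℝ)..1, ‖f s‖ ^ 2) := by
  have := hasSum_sq_fourierCoeffOn zero_lt_one hf
  simp only [fourierCoeffOn_eq_integral, fourier_coe_apply] at this
  simpa using this

lemma integral_norm_sq_integral_shift_le {h : ℝ → ℂ} (hper : Function.Periodic h 1)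
    (hmeas : Measurable h) (hL2 : MemLp h 2 (volume.restrict (Set.Ioc 0 1)))
    (hmean : ∫ s in (0 : ℝ)..1, h s = 0) (t : ℝ) :
    ∫ s in (0 : ℝ)..1, ‖∫ u in (0 : ℝ)..t, h (s + u)‖ ^ 2 ≤
      Real.sin (π * t) ^ 2 / π ^ 2 * ∫ s in (0 : ℝ)..1, ‖h s‖ ^ 2 := by
  have hint : IntervalIntegrable h volume 0 1 :=
    (intervalIntegrable_iff_integrableOn_Ioc_of_le zero_le_one).2 (hL2.integrable one_le_two)
  have hcont := continuous_integral_shift (hper.intervalIntegrable₀ one_ne_zero hint) t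
  have hmem : MemLp (fun s : ℝ => ∫ u in (0 : ℝ)..t, h (s + u)) 2
      (volume.restrict (Set.Ioc 0 1)) := by
    rw [memLp_two_iff_integrable_sq_norm hcont.aestronglyMeasurable]
    exact ((hcont.norm.pow 2).intervalIntegrable 0 1).1
  refine hasSum_le (fun k => ?_) (hasSum_sq_norm_integral_exp_mul hmem)
    ((hasSum_sq_norm_integral_exp_mul hL2).mul_left _)
  rw [integral_exp_mul_integral_shift hper hmeas hint, norm_mul, mul_pow]
  rcases eq_or_ne k 0 with rfl | hk
  · simp [hmean]
  · gcongr
    exact norm_integral_exp_mul_sq_le hk t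

lemma periodic_setLIntegral_Ioc_add {f : ℝ → ENNReal} (hf : Function.Periodic f 1) (r : ℝ) :
    ∫⁻ t in Set.Ioc (0 : ℝ) 1, f (r + t) = ∫⁻ t in Set.Ioc (0 : ℝ) 1, f t := by
  have : VAddInvariantMeasure (AddSubgroup.zmultiples (1 : ℝ)) ℝ volume :=
    ⟨fun c s _ => measure_preimage_add _ _ _⟩
  rw [(measurePreserving_add_left volume r).setLIntegral_comp_emb
    (measurableEmbedding_addLeft r) f, Set.image_const_add_Ioc, add_zero]
  have h := (isAddFundamentalDomain_Ioc zero_lt_one 0).setLIntegral_eq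
    (isAddFundamentalDomain_Ioc (zero_lt_one' ℝ) r) f hf.map_vadd_zmultiples
  rw [← h, zero_add]

lemma integral_norm_sq_sub_shift_le {d : ℕ} {y g : ℝ → EuclideanSpace ℝ (Fin d)}
    (hyper : Function.Periodic y 1) (hgper : Function.Periodic g 1) (hgmeas : Measurable g)
    (hgL2 : MemLp g 2 (volume.restrict (Set.Ioc 0 1)))
    (hg : ∀ a b, IntervalIntegrable g volume a b) (hycont : Continuous y)
    (hfund : ∀ t : ℝ, y t = y 0 + ∫ s in (0 : ℝ)..t, g s) (t : ℝ) :
    ∫ s in (0 : ℝ)..1, ‖y (s + t) - y s‖ ^ 2 ≤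
      Real.sin (π * t) ^ 2 / π ^ 2 * ∫ s in (0 : ℝ)..1, ‖g s‖ ^ 2 := by
  let L : Fin d → EuclideanSpace ℝ (Fin d) →L[ℝ] ℂ := fun i =>
    Complex.ofRealCLM ∘L EuclideanSpace.proj i
  have hL : ∀ x : EuclideanSpace ℝ (Fin d), ‖x‖ ^ 2 = ∑ i, ‖L i x‖ ^ 2 := fun x => by
    simp [L, EuclideanSpace.norm_sq_eq]
  have hdiff : ∀ (i : Fin d) (s : ℝ), L i (y (s + t) - y s) = ∫ u in (0 : ℝ)..t, L i (g (s + u)) := by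
    intro i s
    rw [intervalIntegral.integral_comp_add_left (fun u => L i (g u)), add_zero,
      (L i).intervalIntegral_comp_comm (hg _ _), hfund (s + t), hfund s, add_sub_add_left_eq_sub,
      intervalIntegral.integral_interval_sub_left (hg _ _) (hg _ _)]
  have hmean : ∫ s in (0 : ℝ)..1, g s = 0 := by
    have h1 := hfund 1
    have h2 := hyper 0
    rw [zero_add] at h2
    rw [h2] at h1
    simpa using h1.symm
  have hmem : ∀ i, MemLp (fun s => L i (g s)) 2 (volume.restrict (Set.Ioc 0 1)) := fun i =>
    (L i).comp_memLp' hgL2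
  simp_rw [hL]
  rw [intervalIntegral.integral_finsetSum, intervalIntegral.integral_finsetSum, Finset.mul_sum]
  · refine Finset.sum_le_sum fun i _ => ?_
    simp_rw [hdiff]
    refine integral_norm_sq_integral_shift_le (h := fun s => L i (g s))
      (fun s => by simp only [hgper s]) ((L i).measurable.comp hgmeas) (hmem i) ?_ t
    rw [(L i).intervalIntegral_comp_comm (hg _ _), hmean, map_zero]
  · intro i _
    rw [intervalIntegrable_iff_integrableOn_Ioc_of_le zero_le_one]
    exact (hmem i).integrable_norm_pow two_ne_zero
  · intro i _
    exact Continuous.intervalIntegrable (by fun_prop) _ _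

lemma setLIntegral_prod_sub_eq {E : Type*} [NormedAddCommGroup E] {y : ℝ → E}
    (hyper : Function.Periodic y 1) (hycont : Continuous y) {φ : ℝ → ENNReal} (hφ : Measurable φ) :
    ∫⁻ p in Set.Ioc (0 : ℝ) 1 ×ˢ Set.Ioc (0 : ℝ) 1, φ ‖y p.1 - y p.2‖ =
      ∫⁻ t in Set.Ioc (0 : ℝ) 1, ∫⁻ r in Set.Ioc (0 : ℝ) 1, φ ‖y (r + t) - y r‖ := by
  have h1 : Measurable fun p : ℝ × ℝ => φ ‖y p.1 - y p.2‖ :=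
    hφ.comp (Continuous.measurable (by fun_prop))
  have h2 : Measurable fun p : ℝ × ℝ => φ ‖y (p.1 + p.2) - y p.1‖ :=
    hφ.comp (Continuous.measurable (by fun_prop))
  rw [Measure.volume_eq_prod, setLIntegral_prod_symm _ h1.aemeasurable]
  simp only
  rw [← lintegral_lintegral_swap (f := fun r t => φ ‖y (r + t) - y r‖) h2.aemeasurable]
  refine lintegral_congr fun r => ?_
  exact (periodic_setLIntegral_Ioc_add (f := fun s => φ ‖y s - y r‖)
    (fun s => by simp only [hyper s]) r).symm

lemma ofReal_le_setLIntegral_rpow_neg {E : Type*} [NormedAddCommGroup E] {z : ℝ → E}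
    (hz : Continuous z) {σ a K : ℝ} (hσ : 0 < σ) (ha : 0 < a)
    (hK : ∫ r in (0 : ℝ)..1, ‖z r‖ ^ 2 ≤ K * a ^ 2) :
    ENNReal.ofReal (a ^ (-σ) * (1 + σ / 2 - σ / 2 * K)) ≤
      ∫⁻ r in Set.Ioc (0 : ℝ) 1, ENNReal.ofReal ‖z r‖ ^ (-σ) := by
  have hint : IntervalIntegrable (fun r => σ / 2 * (‖z r‖ ^ 2 / a ^ 2)) volume 0 1 :=
    Continuous.intervalIntegrable (by fun_prop) _ _
  have hval : ∫ r in (0 : ℝ)..1, a ^ (-σ) * (1 + σ / 2 - σ / 2 * (‖z r‖ ^ 2 / a ^ 2)) =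
      a ^ (-σ) * (1 + σ / 2 - σ / 2 * ((∫ r in (0 : ℝ)..1, ‖z r‖ ^ 2) / a ^ 2)) := by
    rw [intervalIntegral.integral_const_mul,
      intervalIntegral.integral_sub intervalIntegrable_const hint,
      intervalIntegral.integral_const_mul, intervalIntegral.integral_div]
    simp
  calc ENNReal.ofReal (a ^ (-σ) * (1 + σ / 2 - σ / 2 * K))
      ≤ ENNReal.ofReal (a ^ (-σ) *
          (1 + σ / 2 - σ / 2 * ((∫ r in (0 : ℝ)..1, ‖z r‖ ^ 2) / a ^ 2))) := by
        have := (div_le_iff₀ (pow_pos ha 2)).2 hK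
        gcongr
    _ ≤ ∫⁻ r in Set.Ioc (0 : ℝ) 1,
          ENNReal.ofReal (a ^ (-σ) * (1 + σ / 2 - σ / 2 * (‖z r‖ ^ 2 / a ^ 2))) := by
        rw [← hval, intervalIntegral.integral_of_le zero_le_one]
        exact ofReal_integral_le_lintegral_ofReal _
    _ ≤ _ := lintegral_mono fun r => ofReal_tangent_le_rpow_neg hσ (norm_nonneg _) ha

/-- Let `0 < σ < 1`, `c = ∫₀¹ (2 sin(πt))^{−σ} dt` and `v² = σc/(8π²)`.
For every 1-periodic zero-mean `H¹` function `y : ℝ → ℝ^d` (represented by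
`y(t) = y(0) + ∫₀ᵗ g` with `g` its 1-periodic weak derivative, square-integrable on
`[0,1]`), the action
`𝒜^σ(y) = ∫₀¹ (v²/2)‖ẏ‖² + (1/2)∫₀¹∫₀¹ ‖y(s) − y(r)‖^{−σ}` (with values in `[0,∞]`,
the potential part being `+∞` e.g. at collisions of positive measure) satisfies
`𝒜^σ(y) ≥ 2π²v²(1 + 2/σ)`. -/
theorem action_lower_bound (d : ℕ) (hd : 2 ≤ d) (σ : ℝ) (hσ0 : 0 < σ) (hσ1 : σ < 1)
    (c : ℝ) (hc : c = ∫ t in (0 : ℝ)..1, (2 * Real.sin (π * t)) ^ (-σ))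
    (v : ℝ) (hv : v ^ 2 = σ * c / (8 * π ^ 2))
    (y g : ℝ → EuclideanSpace ℝ (Fin d))
    (hyper : Function.Periodic y 1)
    (hgper : Function.Periodic g 1)
    (hgmeas : Measurable g)
    (hgL2 : IntegrableOn (fun s => ‖g s‖ ^ 2) (Set.Icc 0 1))
    (hfund : ∀ t : ℝ, y t = y 0 + ∫ s in (0 : ℝ)..t, g s)
    (hmean : (∫ s in (0 : ℝ)..1, y s) = 0) :
    ENNReal.ofReal (2 * π ^ 2 * v ^ 2 * (1 + 2 / σ)) ≤
      ENNReal.ofReal (∫ s in (0 : ℝ)..1, v ^ 2 / 2 * ‖g s‖ ^ 2) +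
        2⁻¹ * ∫⁻ p in Set.Ioc (0 : ℝ) 1 ×ˢ Set.Ioc (0 : ℝ) 1,
          ENNReal.ofReal ‖y p.1 - y p.2‖ ^ (-σ) := by
  have hgmem : MemLp g 2 (volume.restrict (Set.Ioc 0 1)) := by
    rw [memLp_two_iff_integrable_sq_norm hgmeas.aestronglyMeasurable]
    exact hgL2.mono_set Set.Ioc_subset_Icc_self
  have hg : ∀ a b, IntervalIntegrable g volume a b :=
    hgper.intervalIntegrable₀ one_ne_zero <|
      (intervalIntegrable_iff_integrableOn_Ioc_of_le zero_le_one).2 (hgmem.integrable one_le_two)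
  have hycont : Continuous y := by
    rw [funext hfund]
    exact continuous_const.add (intervalIntegral.continuous_primitive hg 0)
  set G : ℝ := ∫ s in (0 : ℝ)..1, ‖g s‖ ^ 2 with hG
  set K : ℝ := 1 + σ / 2 - σ / 2 * (G / (4 * π ^ 2)) with hK
  have hpot : ENNReal.ofReal (c * K) ≤ ∫⁻ p in Set.Ioc (0 : ℝ) 1 ×ˢ Set.Ioc (0 : ℝ) 1,
      ENNReal.ofReal ‖y p.1 - y p.2‖ ^ (-σ) := by
    rw [setLIntegral_prod_sub_eq hyper hycont (φ := fun x => ENNReal.ofReal x ^ (-σ))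
      (by fun_prop), hc, ← intervalIntegral.integral_mul_const,
      intervalIntegral.integral_of_le zero_le_one]
    refine (ofReal_integral_le_lintegral_ofReal _).trans ?_
    rw [← restrict_Ioo_eq_restrict_Ioc]
    refine setLIntegral_mono' measurableSet_Ioo fun t ht => ?_
    rw [restrict_Ioo_eq_restrict_Ioc]
    have hsin : 0 < Real.sin (π * t) :=
      Real.sin_pos_of_pos_of_lt_pi (mul_pos Real.pi_pos ht.1)
        (mul_lt_of_lt_one_right Real.pi_pos ht.2)
    refine ofReal_le_setLIntegral_rpow_neg (z := fun r => y (r + t) - y r) (by fun_prop) hσ0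
      (by positivity) ?_
    refine (integral_norm_sq_sub_shift_le hyper hgper hgmeas hgmem hg hycont hfund t).trans_eq ?_
    field_simp
    ring
  have hkin : ∫ s in (0 : ℝ)..1, v ^ 2 / 2 * ‖g s‖ ^ 2 = v ^ 2 / 2 * G :=
    intervalIntegral.integral_const_mul _ _
  have hsum : 2 * π ^ 2 * v ^ 2 * (1 + 2 / σ) = v ^ 2 / 2 * G + 2⁻¹ * (c * K) := by
    rw [hv, hK]
    field_simp
    ring
  have hhalf : ENNReal.ofReal (2⁻¹ * (c * K)) = 2⁻¹ * ENNReal.ofReal (c * K) := by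
    rw [ENNReal.ofReal_mul (by norm_num), ENNReal.ofReal_inv_of_pos two_pos, ENNReal.ofReal_ofNat]
  rw [hkin, hsum]
  refine ENNReal.ofReal_add_le.trans ?_
  rw [hhalf]
  gcongr
end
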